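/- arXiv:1712.07057 — 3 statements merged into one kernel-verified Lean document; each statement's English description precedes it below -/
import Mathlib

section
/- For any circular matrix A of order m×n, any b ∈ ℤ^m with b ≥ 0, and any β ∈ ℕ, the slice Q_β(A,b) := Q(A,b) ∩ {x ∈ ℝⁿ : 1ᵀx = β} is an integral polytope, i.e., Q_β(A,b) equals the convex hull of its integer points (every vertex of Q_β(A,b) has integer coordinates). -/
namespace CircCover

attribute [local instance] Classical.propDecidable

/-- Membership in the circular interval `[a, a + k)ₙ` of `ZMod n`. -/
def inInterval {n : ℕ} (a : ZMod n) (k : ℕ) (j : ZMod n) : Prop :=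
  ∃ s : ℕ, s < k ∧ j = a + (s : ZMod n)

/-- The `{0,1}`-matrix whose `i`-th row is the incidence vector of `[ℓ i, ℓ i + k i)ₙ`. -/
noncomputable def circMatrix {m n : ℕ} (ℓ : Fin m → ZMod n) (k : Fin m → ℕ) :
    Matrix (Fin m) (ZMod n) ℝ :=
  fun i j => if inInterval (ℓ i) (k i) j then 1 else 0

/-- The condition `2 ≤ kᵢ ≤ n - 1` making `circMatrix ℓ k` a circular matrix. -/
def circBounds (n : ℕ) {m : ℕ} (k : Fin m → ℕ) : Prop :=
  ∀ i, 2 ≤ k i ∧ k i ≤ n - 1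

/-- Arcs of the digraph `D(A)` associated with a circular matrix. -/
inductive Arc (m n : ℕ) : Type
  | fwdRow (i : Fin m)
  | fwdShort (j : ZMod n)
  | revRow (i : Fin m)
  | revShort (j : ZMod n)
  deriving DecidableEq

namespace Arc

variable {m n : ℕ} (ℓ : Fin m → ZMod n) (k : Fin m → ℕ)

/-- The tail of an arc of `D(A)`. -/
def tail : Arc m n → ZMod n
  | fwdRow i => ℓ i - 1
  | fwdShort j => j - 1
  | revRow i => ℓ i + (k i : ZMod n) - 1
  | revShort j => j

/-- The head of an arc of `D(A)`. -/
def head : Arc m n → ZMod n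
  | fwdRow i => ℓ i + (k i : ZMod n) - 1
  | fwdShort j => j
  | revRow i => ℓ i - 1
  | revShort j => j - 1

/-- The oriented length of an arc of `D(A)`. -/
def len (k : Fin m → ℕ) : Arc m n → ℤ
  | fwdRow i => (k i : ℤ)
  | fwdShort _ => 1
  | revRow i => -(k i : ℤ)
  | revShort _ => -1

/-- Forward arcs. -/
def IsForward : Arc m n → Prop
  | fwdRow _ => True
  | fwdShort _ => True
  | _ => False

/-- Forward row arcs. -/
def IsFwdRow : Arc m n → Prop
  | fwdRow _ => True
  | _ => False

/-- Reverse row arcs. -/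
def IsRevRow : Arc m n → Prop
  | revRow _ => True
  | _ => False

/-- Forward short arcs. -/
def IsFwdShort : Arc m n → Prop
  | fwdShort _ => True
  | _ => False

/-- The arc jumps over node `j`. -/
def Jumps : Arc m n → ZMod n → Prop
  | fwdRow i, j => inInterval (ℓ i) (k i) j
  | fwdShort j', j => j' = j
  | revRow i, j => inInterval (ℓ i) (k i) j
  | revShort j', j => j' = j

end Arc

variable {m n : ℕ}

/-- A (not necessarily simple) closed directed path in `D(A)`, given as its list of arcs. -/
def IsClosedWalk (ℓ : Fin m → ZMod n) (k : Fin m → ℕ) (γ : List (Arc m n)) : Prop :=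
  ∃ h : γ ≠ [],
    List.Chain' (fun a b => Arc.head ℓ k a = Arc.tail ℓ k b) γ ∧
      Arc.head ℓ k (γ.getLast h) = Arc.tail ℓ k (γ.head h)

/-- A simple directed circuit in `D(A)`: a closed directed path visiting pairwise
distinct nodes. -/
def IsCircuit (ℓ : Fin m → ZMod n) (k : Fin m → ℕ) (γ : List (Arc m n)) : Prop :=
  IsClosedWalk ℓ k γ ∧ (γ.map (Arc.tail ℓ k)).Nodup

/-- The sum of the oriented lengths of the arcs of `γ`; it equals `p(γ) * n` where `p(γ)`
is the winding number. -/
def windingSum (k : Fin m → ℕ) (γ : List (Arc m n)) : ℤ :=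
  (γ.map (Arc.len k)).sum

/-- `p⁺(γ, j)`: the number of forward arcs of `γ` jumping over `j`. -/
noncomputable def pPlus (ℓ : Fin m → ZMod n) (k : Fin m → ℕ) (γ : List (Arc m n))
    (j : ZMod n) : ℕ :=
  γ.countP fun a => decide (Arc.IsForward a ∧ Arc.Jumps ℓ k a j)

/-- `p⁻(γ, j)`: the number of reverse arcs of `γ` jumping over `j`. -/
noncomputable def pMinus (ℓ : Fin m → ZMod n) (k : Fin m → ℕ) (γ : List (Arc m n))
    (j : ZMod n) : ℕ :=
  γ.countP fun a => decide (¬ Arc.IsForward a ∧ Arc.Jumps ℓ k a j)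

/-- The number of (forward) row arcs of `γ` jumping over `j`. -/
noncomputable def rowJumpCount (ℓ : Fin m → ZMod n) (k : Fin m → ℕ) (γ : List (Arc m n))
    (j : ZMod n) : ℕ :=
  γ.countP fun a => decide (Arc.IsFwdRow a ∧ Arc.Jumps ℓ k a j)

/-- The number of forward row arcs of `γ`. -/
def numRowArcs (γ : List (Arc m n)) : ℕ :=
  γ.countP fun a => match a with | Arc.fwdRow _ => true | _ => false

/-- `t(γ, b) = ∑_{aᵢ ∈ γ} bᵢ - ∑_{āᵢ ∈ γ} bᵢ`. -/
def tVal (b : Fin m → ℤ) (γ : List (Arc m n)) : ℤ :=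
  (γ.map fun a => match a with
    | Arc.fwdRow i => b i
    | Arc.revRow i => -(b i)
    | _ => 0).sum

/-- `t⁻(γ, b) = ∑_{āᵢ ∈ γ} bᵢ`. -/
def tMinusVal (b : Fin m → ℤ) (γ : List (Arc m n)) : ℤ :=
  (γ.map fun a => match a with
    | Arc.revRow i => b i
    | _ => 0).sum

/-- `β(γ, b) = ⌊t(γ, b) / p⌋`. -/
def betaVal (b : Fin m → ℤ) (γ : List (Arc m n)) (p : ℤ) : ℤ :=
  Int.fdiv (tVal b γ) p

/-- `r(γ, b) = t(γ, b) - β(γ, b) * p`. -/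
def rVal (b : Fin m → ℤ) (γ : List (Arc m n)) (p : ℤ) : ℤ :=
  tVal b γ - betaVal b γ p * p

/-- The `γ`-inequality `∑ⱼ (p⁻(γ,j) + r) xⱼ ≥ r (β + 1) + ∑_{āᵢ ∈ γ} bᵢ`. -/
def GammaIneqHolds [NeZero n] (ℓ : Fin m → ZMod n) (k : Fin m → ℕ) (b : Fin m → ℤ)
    (γ : List (Arc m n)) (p : ℤ) (x : ZMod n → ℝ) : Prop :=
  ∑ j : ZMod n, ((pMinus ℓ k γ j : ℝ) + (rVal b γ p : ℝ)) * x j ≥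
    (rVal b γ p : ℝ) * ((betaVal b γ p : ℝ) + 1) + (tMinusVal b γ : ℝ)

/-- The fractional covering polyhedron `Q(A, b) = {x ≥ 0 : A x ≥ b}`. -/
def Qpoly [NeZero n] (A : Matrix (Fin m) (ZMod n) ℝ) (b : Fin m → ℝ) :
    Set (ZMod n → ℝ) :=
  {x | (∀ j, 0 ≤ x j) ∧ ∀ i, b i ≤ ∑ j : ZMod n, A i j * x j}

/-- A point of `ℝⁿ` all whose coordinates are integers. -/
def IsIntegerPoint {n : ℕ} (x : ZMod n → ℝ) : Prop :=
  ∀ j, ∃ z : ℤ, x j = (z : ℝ)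

/-- The covering polyhedron `Q*(A, b) = conv{x ∈ ℤⁿ : x ≥ 0, A x ≥ b}`. -/
noncomputable def Qstar [NeZero n] (A : Matrix (Fin m) (ZMod n) ℝ) (b : Fin m → ℝ) :
    Set (ZMod n → ℝ) :=
  convexHull ℝ {x | IsIntegerPoint x ∧ x ∈ Qpoly A b}

/-- The slack of row `i` of `A` at the point `x`. -/
noncomputable def rowSlack [NeZero n] (ℓ : Fin m → ZMod n) (k : Fin m → ℕ)
    (b : Fin m → ℤ) (x : ZMod n → ℝ) (i : Fin m) : ℝ :=
  (∑ j : ZMod n, circMatrix ℓ k i j * x j) - (b i : ℝ)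

/-- `μ = ⌈1ᵀ x⌉ - 1ᵀ x`. -/
noncomputable def muVal [NeZero n] (x : ZMod n → ℝ) : ℝ :=
  (⌈∑ j : ZMod n, x j⌉ : ℝ) - ∑ j : ZMod n, x j

/-- Entry `i` of the last column `v` of `Ã` (the column indexed by `n ≡ 0`). -/
noncomputable def vRow (ℓ : Fin m → ZMod n) (k : Fin m → ℕ) (i : Fin m) : ℝ :=
  circMatrix ℓ k i 0

/-- Entry `m + j` of the last column `v` of `Ã`. -/
noncomputable def vShort (j : ZMod n) : ℝ :=
  if j = 0 then 1 else 0

/-- The cost of an arc in the weighted digraph `D(A, x)`: forward arcs carry the cost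
`c⁺ = μ (s* - (1 - μ) v)` and reverse arcs the cost `c⁻ = (1 - μ)(s* + μ v)`. -/
noncomputable def arcCost [NeZero n] (ℓ : Fin m → ZMod n) (k : Fin m → ℕ)
    (b : Fin m → ℤ) (x : ZMod n → ℝ) : Arc m n → ℝ
  | Arc.fwdRow i => muVal x * (rowSlack ℓ k b x i - (1 - muVal x) * vRow ℓ k i)
  | Arc.fwdShort j => muVal x * (x j - (1 - muVal x) * vShort j)
  | Arc.revRow i => (1 - muVal x) * (rowSlack ℓ k b x i + muVal x * vRow ℓ k i)
  | Arc.revShort j => (1 - muVal x) * (x j + muVal x * vShort j)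

/-- The cost `c(γ, x)` of a walk `γ` in `D(A, x)`. -/
noncomputable def walkCost [NeZero n] (ℓ : Fin m → ZMod n) (k : Fin m → ℕ)
    (b : Fin m → ℤ) (x : ZMod n → ℝ) (γ : List (Arc m n)) : ℝ :=
  (γ.map (arcCost ℓ k b x)).sum

/-- Row `i` dominates row `i'` of `A`. -/
def Dominates (A : Matrix (Fin m) (ZMod n) ℝ) (i i' : Fin m) : Prop :=
  i ≠ i' ∧ ∀ j, A i' j ≤ A i j

/-- `A` has no dominating rows. -/
def NoDominatingRows (A : Matrix (Fin m) (ZMod n) ℝ) : Prop :=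
  ∀ i i', ¬ Dominates A i i'

/-- The affine dimension of a subset of `ℝⁿ` (`-1` for the empty set). -/
noncomputable def adim [NeZero n] (S : Set (ZMod n → ℝ)) : ℤ :=
  if S = ∅ then -1 else (Module.finrank ℝ (affineSpan ℝ S).direction : ℤ)

/-- The valid inequality `aᵀ x ≥ α₀` defines a facet of `P`:
the face it defines has affine dimension `dim P - 1`. -/
def IsFacetIneq [NeZero n] (P : Set (ZMod n → ℝ)) (a : ZMod n → ℝ) (α₀ : ℝ) : Prop :=
  (∀ x ∈ P, α₀ ≤ ∑ j : ZMod n, a j * x j) ∧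
    adim {x ∈ P | ∑ j : ZMod n, a j * x j = α₀} = adim P - 1

/-- `j` is a node of the walk `γ`. -/
def IsNodeOf (ℓ : Fin m → ZMod n) (k : Fin m → ℕ) (γ : List (Arc m n)) (j : ZMod n) : Prop :=
  ∃ a ∈ γ, Arc.tail ℓ k a = j

/-- `j` is an essential bullet of `γ`: a node of `γ` which is neither a circle
(head of a forward short arc of `γ`) nor a cross (tail of a reverse short arc of `γ`). -/
def IsEssentialBullet (ℓ : Fin m → ZMod n) (k : Fin m → ℕ) (γ : List (Arc m n))
    (j : ZMod n) : Prop :=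
  IsNodeOf ℓ k γ j ∧ Arc.fwdShort j ∉ γ ∧ Arc.revShort j ∉ γ

/-- The number of essential bullets of `γ`. -/
noncomputable def numEssentialBullets [NeZero n] (ℓ : Fin m → ZMod n) (k : Fin m → ℕ)
    (γ : List (Arc m n)) : ℕ :=
  (Finset.univ.filter fun j : ZMod n => IsEssentialBullet ℓ k γ j).card

/-- `∑_{i ∈ F} a_{ij}`, the number of rows of `F` whose interval contains `j`. -/
noncomputable def rowCount (ℓ : Fin m → ZMod n) (k : Fin m → ℕ) (F : Finset (Fin m))
    (j : ZMod n) : ℕ :=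
  (F.filter fun i => inInterval (ℓ i) (k i) j).card

/-- The row family inequality induced by `F` (with `p* = max_j ∑_{i ∈ F} a_{ij} - 1`). -/
def RowFamilyIneqHolds [NeZero n] (ℓ : Fin m → ZMod n) (k : Fin m → ℕ)
    (F : Finset (Fin m)) (x : ZMod n → ℝ) : Prop :=
  let s := F.card
  let pstar := (Finset.univ.sup fun j : ZMod n => rowCount ℓ k F j) - 1
  let rstar := s - pstar * (s / pstar)
  ((rstar : ℝ) + 1) * ∑ j ∈ Finset.univ.filter (fun j : ZMod n => rowCount ℓ k F j = pstar + 1), x j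
    + (rstar : ℝ) * ∑ j ∈ Finset.univ.filter (fun j : ZMod n => rowCount ℓ k F j ≤ pstar), x j
    ≥ (rstar : ℝ) * (((s + pstar - 1) / pstar : ℕ) : ℝ)

/-- The incidence vector of a circular interval of length at most `n` picks out a sum of
consecutive entries. -/
lemma sum_inInterval_mul [NeZero n] (a : ZMod n) {k : ℕ} (hk : k ≤ n) (x : ZMod n → ℝ) :
    ∑ j : ZMod n, (if inInterval a k j then (1 : ℝ) else 0) * x j =
      ∑ s ∈ Finset.range k, x (a + (s : ZMod n)) := by
  simp only [ite_mul, one_mul, zero_mul]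
  rw [← Finset.sum_filter]
  symm
  refine Finset.sum_bij (fun s _ => a + (s : ZMod n)) ?_ ?_ ?_ (fun _ _ => rfl)
  · intro s hs
    exact Finset.mem_filter.2 ⟨Finset.mem_univ _, s, Finset.mem_range.1 hs, rfl⟩
  · intro s hs t ht h
    have h' := (ZMod.natCast_eq_natCast_iff' s t n).1 (add_left_cancel h)
    rwa [Nat.mod_eq_of_lt ((Finset.mem_range.1 hs).trans_le hk),
      Nat.mod_eq_of_lt ((Finset.mem_range.1 ht).trans_le hk)] at h'
  · intro j hj
    obtain ⟨s, hs, rfl⟩ := (Finset.mem_filter.1 hj).2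
    exact ⟨s, Finset.mem_range.2 hs, rfl⟩

lemma sum_univ_eq_sum_range [NeZero n] (x : ZMod n → ℝ) :
    ∑ j : ZMod n, x j = ∑ s ∈ Finset.range n, x (s : ZMod n) := by
  have h := sum_inInterval_mul (0 : ZMod n) le_rfl x
  have hall (j : ZMod n) : inInterval 0 n j := ⟨j.val, j.val_lt, by simp⟩
  simpa [hall] using h

/-- The partial sums of the `n`-periodic sequence given by `x`. -/
noncomputable def partialSum (x : ZMod n → ℝ) (t : ℕ) : ℝ :=
  ∑ s ∈ Finset.range t, x (s : ZMod n)

lemma partialSum_succ (x : ZMod n → ℝ) (t : ℕ) :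
    partialSum x (t + 1) = partialSum x t + x (t : ZMod n) :=
  Finset.sum_range_succ _ _

lemma partialSum_add (x : ZMod n → ℝ) (a k : ℕ) :
    partialSum x (a + k) =
      partialSum x a + ∑ s ∈ Finset.range k, x ((a + s : ℕ) : ZMod n) :=
  Finset.sum_range_add _ _ _

lemma partialSum_mod_add [NeZero n] {x : ZMod n → ℝ} {β : ℕ} (hx : ∑ j, x j = β) (t : ℕ) :
    partialSum x t = partialSum x (t % n) + ((t / n * β : ℕ) : ℝ) := by
  have step (r q : ℕ) : partialSum x (r + n * q) = partialSum x r + ((q * β : ℕ) : ℝ) := by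
    induction q with
    | zero => simp
    | succ q ih =>
      have hn : partialSum x n = β := (sum_univ_eq_sum_range x).symm.trans hx
      have hs : partialSum x (r + n * (q + 1)) = partialSum x (n + (r + n * q)) := by
        congr 1; ring
      rw [hs, partialSum_add, hn]
      simp only [Nat.cast_add, CharP.cast_eq_zero, zero_add]
      have : ∑ s ∈ Finset.range (r + n * q), x (s : ZMod n) = partialSum x (r + n * q) := rfl
      rw [this, ih]
      push_cast
      ring
  conv_lhs => rw [← Nat.mod_add_div t n]
  exact step _ _

/-- The integer point obtained by rounding down the partial sums of `x` shifted by `θ`. -/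
noncomputable def roundedPoint (x : ZMod n → ℝ) (θ : ℝ) (j : ZMod n) : ℝ :=
  (⌊partialSum x (j.val + 1) + θ⌋ : ℝ) - (⌊partialSum x j.val + θ⌋ : ℝ)

lemma roundedPoint_natCast [NeZero n] {x : ZMod n → ℝ} {β : ℕ} (hx : ∑ j, x j = β)
    (θ : ℝ) (t : ℕ) :
    roundedPoint x θ (t : ZMod n) =
      (⌊partialSum x (t + 1) + θ⌋ : ℝ) - (⌊partialSum x t + θ⌋ : ℝ) := by
  rw [roundedPoint, partialSum_succ, partialSum_succ, ZMod.val_natCast, partialSum_mod_add hx t,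
    ZMod.natCast_mod]
  have h1 : partialSum x (t % n) + ((t / n * β : ℕ) : ℝ) + x t + θ =
      partialSum x (t % n) + x t + θ + ((t / n * β : ℕ) : ℝ) := by ring
  have h2 : partialSum x (t % n) + ((t / n * β : ℕ) : ℝ) + θ =
      partialSum x (t % n) + θ + ((t / n * β : ℕ) : ℝ) := by ring
  rw [h1, h2, Int.floor_add_natCast, Int.floor_add_natCast]
  push_cast
  ring

lemma sum_roundedPoint [NeZero n] {x : ZMod n → ℝ} {β : ℕ} (hx : ∑ j, x j = β)
    (θ : ℝ) (a k : ℕ) :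
    ∑ s ∈ Finset.range k, roundedPoint x θ ((a + s : ℕ) : ZMod n) =
      (⌊partialSum x (a + k) + θ⌋ : ℝ) - (⌊partialSum x a + θ⌋ : ℝ) := by
  simp only [roundedPoint_natCast hx]
  exact Finset.sum_range_sub (fun s => (⌊partialSum x (a + s) + θ⌋ : ℝ)) k

lemma le_floor_sub_floor {u v : ℝ} {c : ℤ} (h : (c : ℝ) ≤ u - v) (θ : ℝ) :
    (c : ℝ) ≤ (⌊u + θ⌋ : ℝ) - (⌊v + θ⌋ : ℝ) := by
  have : ⌊v + θ⌋ + c ≤ ⌊u + θ⌋ := by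
    rw [← Int.floor_add_intCast]
    exact Int.floor_mono (by linarith)
  have : (⌊v + θ⌋ : ℝ) + c ≤ (⌊u + θ⌋ : ℝ) := by exact_mod_cast this
  linarith

lemma sum_circMatrix_mul [NeZero n] (ℓ : Fin m → ZMod n) {k : Fin m → ℕ} (hA : circBounds n k)
    (x : ZMod n → ℝ) (i : Fin m) :
    ∑ j : ZMod n, circMatrix ℓ k i j * x j =
      ∑ s ∈ Finset.range (k i), x (((ℓ i).val + s : ℕ) : ZMod n) := by
  simpa [circMatrix] using
    sum_inInterval_mul (ℓ i) ((hA i).2.trans (Nat.sub_le n 1)) x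

lemma roundedPoint_mem [NeZero n] {ℓ : Fin m → ZMod n} {k : Fin m → ℕ} (hA : circBounds n k)
    {b : Fin m → ℤ} {β : ℕ} {x : ZMod n → ℝ}
    (hxQ : x ∈ Qpoly (circMatrix ℓ k) (fun i => (b i : ℝ))) (hx : ∑ j, x j = β) (θ : ℝ) :
    roundedPoint x θ ∈ (Qpoly (circMatrix ℓ k) (fun i => (b i : ℝ)) ∩
      {x | ∑ j : ZMod n, x j = (β : ℝ)}) ∩ {x | IsIntegerPoint x} := by
  refine ⟨⟨⟨fun j => ?_, fun i => ?_⟩, ?_⟩, fun j => ?_⟩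
  · have h : ((0 : ℤ) : ℝ) ≤ partialSum x (j.val + 1) - partialSum x j.val := by
      rw [partialSum_succ]
      simpa using hxQ.1 j
    simpa [roundedPoint] using le_floor_sub_floor h θ
  · have h := hxQ.2 i
    rw [sum_circMatrix_mul ℓ hA] at h ⊢
    rw [sum_roundedPoint hx]
    refine le_floor_sub_floor ?_ θ
    rw [partialSum_add]
    linarith
  · have hn : partialSum x n = β := (sum_univ_eq_sum_range x).symm.trans hx
    have h0 : partialSum x 0 = 0 := by simp [partialSum]
    have h := sum_roundedPoint hx θ 0 n
    simp only [zero_add, hn, h0] at h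
    rw [Set.mem_ofPred_eq, sum_univ_eq_sum_range, h, add_comm (β : ℝ) θ, Int.floor_add_natCast]
    push_cast
    ring
  · exact ⟨⌊partialSum x (j.val + 1) + θ⌋ - ⌊partialSum x j.val + θ⌋, by
      simp [roundedPoint]⟩

lemma intervalIntegrable_fract_add (u p q : ℝ) :
    IntervalIntegrable (fun θ : ℝ => Int.fract (u + θ)) MeasureTheory.volume p q := by
  refine (intervalIntegrable_const (c := (1 : ℝ))).mono_fun
    (measurable_fract.comp (measurable_const_add u)).aestronglyMeasurable (.of_forall fun θ => ?_)
  simpa [abs_of_nonneg (Int.fract_nonneg (u + θ))] using (Int.fract_lt_one (u + θ)).le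

lemma floor_sub_floor_eq (u v θ : ℝ) :
    (⌊u + θ⌋ : ℝ) - (⌊v + θ⌋ : ℝ) =
      (u - v) - (Int.fract (u + θ) - Int.fract (v + θ)) := by
  simp only [Int.fract]
  ring

lemma intervalIntegrable_floor_sub_floor (u v p q : ℝ) :
    IntervalIntegrable (fun θ : ℝ => (⌊u + θ⌋ : ℝ) - (⌊v + θ⌋ : ℝ))
      MeasureTheory.volume p q := by
  simp only [floor_sub_floor_eq]
  exact intervalIntegrable_const.sub
    ((intervalIntegrable_fract_add u p q).sub (intervalIntegrable_fract_add v p q))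

lemma integral_floor_sub_floor (u v : ℝ) :
    ∫ θ in (0 : ℝ)..1, ((⌊u + θ⌋ : ℝ) - (⌊v + θ⌋ : ℝ)) = u - v := by
  have hper (w : ℝ) : ∫ θ in (0 : ℝ)..1, Int.fract (w + θ) =
      ∫ θ in (0 : ℝ)..(0 + 1), (Int.fract θ : ℝ) := by
    rw [intervalIntegral.integral_comp_add_left (fun θ : ℝ => Int.fract θ) w, add_zero]
    exact (Int.fract_periodic ℝ).intervalIntegral_add_eq w 0
  simp only [floor_sub_floor_eq]
  rw [intervalIntegral.integral_sub intervalIntegrable_const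
      ((intervalIntegrable_fract_add u 0 1).sub (intervalIntegrable_fract_add v 0 1)),
    intervalIntegral.integral_sub (intervalIntegrable_fract_add u 0 1)
      (intervalIntegrable_fract_add v 0 1), hper, hper]
  simp

/-- Averaging the rounded points over all shifts recovers the original point. -/
lemma integral_roundedPoint [NeZero n] (x : ZMod n → ℝ) :
    MeasureTheory.Integrable (roundedPoint x)
        (MeasureTheory.volume.restrict (Set.Ioc (0 : ℝ) 1)) ∧
      ∫ θ in Set.Ioc (0 : ℝ) 1, roundedPoint x θ = x := by
  have hint (j : ZMod n) : MeasureTheory.Integrable (fun θ => roundedPoint x θ j)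
      (MeasureTheory.volume.restrict (Set.Ioc (0 : ℝ) 1)) :=
    (intervalIntegrable_iff_integrableOn_Ioc_of_le zero_le_one).1
      (intervalIntegrable_floor_sub_floor _ _ 0 1)
  refine ⟨MeasureTheory.Integrable.of_eval hint, funext fun j => ?_⟩
  rw [MeasureTheory.eval_integral hint, ← intervalIntegral.integral_of_le zero_le_one]
  refine (integral_floor_sub_floor _ _).trans ?_
  rw [partialSum_succ]
  simp

lemma finite_integerPoints_slice [NeZero n] (β : ℕ) :
    {x : ZMod n → ℝ | (∀ j, 0 ≤ x j) ∧ ∑ j, x j = (β : ℝ) ∧ IsIntegerPoint x}.Finite := by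
  refine (Set.Finite.pi' fun _ : ZMod n =>
    (Set.finite_Icc (0 : ℤ) β).image (fun z : ℤ => (z : ℝ))).subset ?_
  rintro x ⟨h0, hs, hz⟩ j
  obtain ⟨z, hj⟩ := hz j
  refine ⟨z, ⟨?_, ?_⟩, hj.symm⟩
  · have := h0 j
    rw [hj] at this
    exact_mod_cast this
  · have := Finset.single_le_sum (fun i _ => h0 i) (Finset.mem_univ j)
    rw [hs, hj] at this
    exact_mod_cast this

lemma convex_slice [NeZero n] (A : Matrix (Fin m) (ZMod n) ℝ) (b : Fin m → ℝ) (c : ℝ) :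
    Convex ℝ (Qpoly A b ∩ {x | ∑ j : ZMod n, x j = c}) := by
  have hlin (w x y : ZMod n → ℝ) (p q : ℝ) : ∑ j, w j * (p • x + q • y) j =
      p * ∑ j, w j * x j + q * ∑ j, w j * y j := by
    rw [Finset.mul_sum, Finset.mul_sum, ← Finset.sum_add_distrib]
    refine Finset.sum_congr rfl fun j _ => ?_
    simp only [Pi.add_apply, Pi.smul_apply, smul_eq_mul]
    ring
  rintro x ⟨⟨hx0, hxA⟩, hx⟩ y ⟨⟨hy0, hyA⟩, hy⟩ p q hp hq hpq
  refine ⟨⟨fun j => ?_, fun i => ?_⟩, ?_⟩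
  · exact add_nonneg (mul_nonneg hp (hx0 j)) (mul_nonneg hq (hy0 j))
  · rw [hlin]
    calc b i = p * b i + q * b i := by rw [← add_mul, hpq, one_mul]
      _ ≤ _ := add_le_add (mul_le_mul_of_nonneg_left (hxA i) hp)
        (mul_le_mul_of_nonneg_left (hyA i) hq)
  · have h := hlin 1 x y p q
    simp only [Pi.one_apply, one_mul] at h
    rw [Set.mem_ofPred_eq] at hx hy ⊢
    rw [h, hx, hy, ← add_mul, hpq, one_mul]

/-- For any circular matrix `A`, any `b ∈ ℤ^m` with `b ≥ 0` and any
`β ∈ ℕ`, the slice `Q_β(A, b) = Q(A, b) ∩ {x : 1ᵀ x = β}` is an integral polytope: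
it equals the convex hull of its integer points. -/
theorem slice_of_Q_is_integral {m n : ℕ} [NeZero n] (ℓ : Fin m → ZMod n) (k : Fin m → ℕ)
    (hA : circBounds n k) (b : Fin m → ℤ) (hb : ∀ i, 0 ≤ b i) (β : ℕ) :
    Qpoly (circMatrix ℓ k) (fun i => (b i : ℝ)) ∩ {x | ∑ j : ZMod n, x j = (β : ℝ)} =
      convexHull ℝ ((Qpoly (circMatrix ℓ k) (fun i => (b i : ℝ)) ∩
        {x | ∑ j : ZMod n, x j = (β : ℝ)}) ∩ {x | IsIntegerPoint x}) := by
  refine Set.Subset.antisymm ?_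
    (convexHull_min Set.inter_subset_left (convex_slice _ _ _))
  rintro x ⟨hxQ, hx⟩
  obtain ⟨hint, hval⟩ := integral_roundedPoint x
  have : MeasureTheory.IsProbabilityMeasure
      (MeasureTheory.volume.restrict (Set.Ioc (0 : ℝ) 1)) := ⟨by simp⟩
  have hfin := (finite_integerPoints_slice (n := n) β).subset
    (t := (Qpoly (circMatrix ℓ k) (fun i => (b i : ℝ)) ∩
        {x | ∑ j : ZMod n, x j = (β : ℝ)}) ∩ {x | IsIntegerPoint x})
    fun y hy => ⟨hy.1.1.1, hy.1.2, hy.2⟩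
  rw [← hval]
  exact (convex_convexHull ℝ _).integral_mem (hfin.isClosed_convexHull ℝ)
    (.of_forall fun θ => subset_convexHull ℝ _ (roundedPoint_mem hA hxQ hx θ)) hint

end CircCover
end

section
/- Let A be a circular matrix of order m×n, b ∈ ℤ^m with b ≥ 0, x* ∈ Q(A,b) \ Q*(A,b), and Γ a simple directed circuit in D(A,x*) with negative cost c(Γ,x*) < 0. Then the winding number of Γ is positive: p(Γ) > 0. -/
namespace CircCover

attribute [local instance] Classical.propDecidable

variable {m n : ℕ}

theorem inInterval_zero_iff [NeZero n] (a : ZMod n) {k : ℕ} :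
    inInterval (a + 1) k 0 ↔ n ≤ a.val + k := by
  have ha := ZMod.val_lt a
  have hcast (s : ℕ) : a + 1 + (s : ZMod n) = ((a.val + 1 + s : ℕ) : ZMod n) := by
    simp
  constructor
  · rintro ⟨s, hs, h0⟩
    rw [hcast, eq_comm, ZMod.natCast_eq_zero_iff] at h0
    have := Nat.le_of_dvd (by omega) h0
    omega
  · intro h
    refine ⟨n - 1 - a.val, by omega, ?_⟩
    rw [hcast, show a.val + 1 + (n - 1 - a.val) = n by omega, ZMod.natCast_self]

theorem val_add_natCast_sub_val [NeZero n] (a : ZMod n) {k : ℕ} (hk : k ≤ n) :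
    (k : ℤ) = (a + (k : ZMod n)).val - a.val + n * (if inInterval (a + 1) k 0 then 1 else 0) := by
  have ha := ZMod.val_lt a
  have hval : (a + (k : ZMod n)).val = (a.val + k) % n := by
    rw [← ZMod.val_natCast]
    simp
  rw [hval]
  by_cases h : n ≤ a.val + k
  · rw [if_pos ((inInterval_zero_iff a).2 h), Nat.mod_eq_sub_mod h]
    by_cases h' : a.val + k - n < n
    · rw [Nat.mod_eq_of_lt h']
      omega
    · omega
  · rw [if_neg (mt (inInterval_zero_iff a).1 h), Nat.mod_eq_of_lt (by omega)]
    push_cast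
    ring

/-- The signed number of times an arc jumps over the node `0`. -/
noncomputable def Arc.crossing (ℓ : Fin m → ZMod n) (k : Fin m → ℕ) : Arc m n → ℤ
  | .fwdRow i => if inInterval (ℓ i) (k i) 0 then 1 else 0
  | .fwdShort j => if j = 0 then 1 else 0
  | .revRow i => -if inInterval (ℓ i) (k i) 0 then 1 else 0
  | .revShort j => -if j = 0 then 1 else 0

theorem inInterval_one_zero_iff (j : ZMod n) : inInterval j 1 0 ↔ j = 0 := by
  simp [inInterval, eq_comm]

theorem Arc.len_eq [NeZero n] (ℓ : Fin m → ZMod n) {k : Fin m → ℕ} (hk : ∀ i, k i ≤ n)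
    (a : Arc m n) :
    a.len k = ((a.head ℓ k).val - (a.tail ℓ k).val : ℤ) + n * a.crossing ℓ k := by
  have hrow (i : Fin m) := val_add_natCast_sub_val (ℓ i - 1) (hk i)
  have hshort (j : ZMod n) := val_add_natCast_sub_val (j - 1) (NeZero.one_le : 1 ≤ n)
  simp only [sub_add_cancel, sub_add_eq_add_sub] at hrow
  simp only [sub_add_cancel, Nat.cast_one, inInterval_one_zero_iff] at hshort
  cases a with
  | fwdRow i =>
    simp only [Arc.len, Arc.head, Arc.tail, Arc.crossing]
    linarith [hrow i]
  | fwdShort j => exact hshort j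
  | revRow i =>
    simp only [Arc.len, Arc.head, Arc.tail, Arc.crossing]
    linarith [hrow i]
  | revShort j =>
    simp only [Arc.len, Arc.head, Arc.tail, Arc.crossing]
    linarith [hshort j]

theorem windingSum_eq [NeZero n] (ℓ : Fin m → ZMod n) {k : Fin m → ℕ} (hk : ∀ i, k i ≤ n)
    (γ : List (Arc m n)) (hne : γ ≠ [])
    (hγ : γ.IsChain fun a b => Arc.head ℓ k a = Arc.tail ℓ k b) :
    windingSum k γ = (((γ.getLast hne).head ℓ k).val - ((γ.head hne).tail ℓ k).val : ℤ)
      + n * (γ.map (Arc.crossing ℓ k)).sum := by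
  induction γ with
  | nil => exact absurd rfl hne
  | cons a γ ih =>
    cases γ with
    | nil => simpa [windingSum] using a.len_eq ℓ hk
    | cons a' γ =>
      rw [List.isChain_cons_cons] at hγ
      have h := ih (by simp) hγ.2
      have ha := a.len_eq ℓ hk
      rw [hγ.1] at ha
      simp only [windingSum, List.map_cons, List.sum_cons, List.head_cons,
        List.getLast_cons_cons] at h ⊢
      rw [h, ha]
      ring

theorem windingSum_eq_mul_crossing [NeZero n] {ℓ : Fin m → ZMod n} {k : Fin m → ℕ}
    (hk : ∀ i, k i ≤ n) {γ : List (Arc m n)} (hγ : IsClosedWalk ℓ k γ) :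
    windingSum k γ = n * (γ.map (Arc.crossing ℓ k)).sum := by
  obtain ⟨hne, hchain, hclosed⟩ := hγ
  rw [windingSum_eq ℓ hk γ hne hchain, hclosed]
  ring

theorem muVal_nonneg [NeZero n] (x : ZMod n → ℝ) : 0 ≤ muVal x :=
  sub_nonneg.2 (Int.le_ceil _)

theorem muVal_lt_one [NeZero n] (x : ZMod n → ℝ) : muVal x < 1 := by
  have := Int.ceil_lt_add_one (∑ j : ZMod n, x j)
  unfold muVal
  linarith

theorem neg_crossing_le_arcCost [NeZero n] {ℓ : Fin m → ZMod n} {k : Fin m → ℕ} {b : Fin m → ℤ}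
    {x : ZMod n → ℝ} (hx : x ∈ Qpoly (circMatrix ℓ k) (fun i => (b i : ℝ))) (a : Arc m n) :
    -(muVal x * (1 - muVal x)) * (a.crossing ℓ k : ℝ) ≤ arcCost ℓ k b x a := by
  have hμ := muVal_nonneg x
  have hμ' : 0 ≤ 1 - muVal x := sub_nonneg.2 (muVal_lt_one x).le
  have hs (i : Fin m) : 0 ≤ rowSlack ℓ k b x i := sub_nonneg.2 (hx.2 i)
  cases a with
  | fwdRow i =>
    simp only [Arc.crossing, arcCost, vRow, circMatrix]
    push_cast
    linarith [mul_nonneg hμ (hs i)]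
  | fwdShort j =>
    simp only [Arc.crossing, arcCost, vShort]
    push_cast
    linarith [mul_nonneg hμ (hx.1 j)]
  | revRow i =>
    simp only [Arc.crossing, arcCost, vRow, circMatrix]
    push_cast
    linarith [mul_nonneg hμ' (hs i)]
  | revShort j =>
    simp only [Arc.crossing, arcCost, vShort]
    push_cast
    linarith [mul_nonneg hμ' (hx.1 j)]

theorem neg_crossing_le_walkCost [NeZero n] {ℓ : Fin m → ZMod n} {k : Fin m → ℕ} {b : Fin m → ℤ}
    {x : ZMod n → ℝ} (hx : x ∈ Qpoly (circMatrix ℓ k) (fun i => (b i : ℝ)))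
    (γ : List (Arc m n)) :
    -(muVal x * (1 - muVal x)) * ((γ.map (Arc.crossing ℓ k)).sum : ℤ) ≤ walkCost ℓ k b x γ := by
  induction γ with
  | nil => simp [walkCost]
  | cons a γ ih =>
    simp only [walkCost, List.map_cons, List.sum_cons] at ih ⊢
    push_cast at ih ⊢
    linarith [neg_crossing_le_arcCost hx a]

/-- If `x* ∈ Q(A, b) \ Q*(A, b)` and `Γ` is a simple directed circuit
of negative cost in `D(A, x*)`, then the winding number of `Γ` is positive. -/
theorem winding_pos_of_neg_cost_circuit {m n : ℕ} [NeZero n] (ℓ : Fin m → ZMod n)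
    (k : Fin m → ℕ) (hA : circBounds n k) (b : Fin m → ℤ) (hb : ∀ i, 0 ≤ b i)
    (x : ZMod n → ℝ) (hx : x ∈ Qpoly (circMatrix ℓ k) (fun i => (b i : ℝ)))
    (hx' : x ∉ Qstar (circMatrix ℓ k) (fun i => (b i : ℝ)))
    (γ : List (Arc m n)) (hγ : IsCircuit ℓ k γ) (hneg : walkCost ℓ k b x γ < 0)
    (p : ℤ) (hp : p * (n : ℤ) = windingSum k γ) :
    0 < p := by
  have hk (i : Fin m) : k i ≤ n := (hA i).2.trans (Nat.sub_le n 1)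
  have hn : (n : ℤ) ≠ 0 := by exact_mod_cast NeZero.ne n
  have hpc : p = (γ.map (Arc.crossing ℓ k)).sum := by
    rw [windingSum_eq_mul_crossing hk hγ.1, mul_comm] at hp
    exact mul_left_cancel₀ hn hp
  have hcost := neg_crossing_le_walkCost hx γ
  rw [← hpc] at hcost
  by_contra! hp0
  have hp0' : (p : ℝ) ≤ 0 := by exact_mod_cast hp0
  have hμ : 0 ≤ muVal x * (1 - muVal x) :=
    mul_nonneg (muVal_nonneg x) (sub_nonneg.2 (muVal_lt_one x).le)
  linarith [mul_nonneg_of_nonpos_of_nonpos (neg_nonpos.2 hμ) hp0']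

end CircCover
end

section
/- Let A be a circular matrix of order m×n, b ∈ ℤ^m with b ≥ 0, and Γ a simple directed circuit in D(A) with winding number p(Γ) > 0. Then the Γ-inequality Σ_{j ∈ ZMod n} (p⁻(Γ,j) + r(Γ,b)) x_j ≥ r(Γ,b)(β(Γ,b)+1) + Σ_{i : ā_i ∈ E(Γ)} b_i is valid for Q*(A,b), i.e., every point of Q*(A,b) satisfies it. -/
namespace CircCover

attribute [local instance] Classical.propDecidable

variable {m n : ℕ}

/-- The indicator of a circular interval of length at most `n` is a sum of point indicators. -/
lemma ite_inInterval_eq_sum [NeZero n] (a : ZMod n) {k : ℕ} (hk : k ≤ n) (j : ZMod n) :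
    (if inInterval a k j then (1 : ℤ) else 0) =
      ∑ s ∈ Finset.range k, if j = a + (s : ZMod n) then (1 : ℤ) else 0 := by
  split_ifs with h
  · obtain ⟨s, hs, rfl⟩ := h
    rw [Finset.sum_eq_single s]
    · simp
    · intro t ht hts
      rw [if_neg]
      intro h
      apply hts
      have h' := (ZMod.natCast_eq_natCast_iff' s t n).1 (add_left_cancel h)
      rw [Nat.mod_eq_of_lt (hs.trans_le hk),
        Nat.mod_eq_of_lt ((Finset.mem_range.1 ht).trans_le hk)] at h'
      exact h'.symm
    · intro h'
      exact absurd (Finset.mem_range.2 hs) h'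
  · refine (Finset.sum_eq_zero fun s hs => if_neg fun h' => h ?_).symm
    exact ⟨s, Finset.mem_range.1 hs, h'⟩

lemma sum_ite_inInterval [NeZero n] (a : ZMod n) {k : ℕ} (hk : k ≤ n) :
    ∑ j : ZMod n, (if inInterval a k j then (1 : ℤ) else 0) = k := by
  simp_rw [ite_inInterval_eq_sum a hk]
  rw [Finset.sum_comm]
  simp

lemma ite_inInterval_sub_succ [NeZero n] (a : ZMod n) {k : ℕ} (hk : k ≤ n) (j : ZMod n) :
    (if inInterval a k j then (1 : ℤ) else 0) - (if inInterval a k (j + 1) then 1 else 0) =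
      (if j = a + (k : ZMod n) - 1 then 1 else 0) - (if j = a - 1 then 1 else 0) := by
  rw [ite_inInterval_eq_sum a hk, ite_inInterval_eq_sum a hk, ← Finset.sum_sub_distrib]
  have h := Finset.sum_range_sub
    (fun s : ℕ => if j = a + (s : ZMod n) - 1 then (1 : ℤ) else 0) k
  simp only [Nat.cast_zero, add_zero] at h
  rw [← h]
  refine Finset.sum_congr rfl fun s _ => ?_
  have h1 : a + ((s + 1 : ℕ) : ZMod n) - 1 = a + (s : ZMod n) := by push_cast; ring
  rw [h1]
  simp only [eq_sub_iff_add_eq]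

/-- The signed indicator of the nodes over which an arc jumps. -/
noncomputable def Arc.signedJump (ℓ : Fin m → ZMod n) (k : Fin m → ℕ) (a : Arc m n)
    (j : ZMod n) : ℤ :=
  (if Arc.IsForward a ∧ Arc.Jumps ℓ k a j then 1 else 0) -
    (if ¬ Arc.IsForward a ∧ Arc.Jumps ℓ k a j then 1 else 0)

lemma Arc.sum_signedJump [NeZero n] (ℓ : Fin m → ZMod n) (k : Fin m → ℕ)
    (hk : ∀ i, k i ≤ n) (a : Arc m n) :
    ∑ j : ZMod n, Arc.signedJump ℓ k a j = Arc.len k a := by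
  cases a with
  | fwdRow i => simpa [signedJump, IsForward, Jumps, len] using sum_ite_inInterval (ℓ i) (hk i)
  | fwdShort j => simp [signedJump, IsForward, Jumps, len]
  | revRow i => simpa [signedJump, IsForward, Jumps, len] using sum_ite_inInterval (ℓ i) (hk i)
  | revShort j => simp [signedJump, IsForward, Jumps, len]

lemma Arc.signedJump_sub_succ [NeZero n] (ℓ : Fin m → ZMod n) (k : Fin m → ℕ)
    (hk : ∀ i, k i ≤ n) (a : Arc m n) (j : ZMod n) :
    Arc.signedJump ℓ k a j - Arc.signedJump ℓ k a (j + 1) =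
      (if j = Arc.head ℓ k a then 1 else 0) - (if j = Arc.tail ℓ k a then 1 else 0) := by
  cases a with
  | fwdRow i =>
    have h := ite_inInterval_sub_succ (ℓ i) (hk i) j
    simp only [signedJump, IsForward, Jumps, head, tail, not_true_eq_false, false_and, true_and,
      if_false]
    grind
  | fwdShort j' =>
    simp only [signedJump, IsForward, Jumps, head, tail, not_true_eq_false, false_and, true_and,
      if_false]
    grind
  | revRow i =>
    have h := ite_inInterval_sub_succ (ℓ i) (hk i) j
    simp only [signedJump, IsForward, Jumps, head, tail, false_and, not_false_eq_true, true_and,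
      if_false]
    grind
  | revShort j' =>
    simp only [signedJump, IsForward, Jumps, head, tail, false_and, not_false_eq_true, true_and,
      if_false]
    grind

lemma pPlus_cons (ℓ : Fin m → ZMod n) (k : Fin m → ℕ) (a : Arc m n) (γ : List (Arc m n))
    (j : ZMod n) :
    pPlus ℓ k (a :: γ) j =
      pPlus ℓ k γ j + if Arc.IsForward a ∧ Arc.Jumps ℓ k a j then 1 else 0 := by
  simp [pPlus, List.countP_cons]

lemma pMinus_cons (ℓ : Fin m → ZMod n) (k : Fin m → ℕ) (a : Arc m n) (γ : List (Arc m n))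
    (j : ZMod n) :
    pMinus ℓ k (a :: γ) j =
      pMinus ℓ k γ j + if ¬ Arc.IsForward a ∧ Arc.Jumps ℓ k a j then 1 else 0 := by
  simp [pMinus, List.countP_cons]

lemma pPlus_sub_pMinus (ℓ : Fin m → ZMod n) (k : Fin m → ℕ) (γ : List (Arc m n))
    (j : ZMod n) :
    (pPlus ℓ k γ j : ℤ) - pMinus ℓ k γ j =
      (γ.map fun a => Arc.signedJump ℓ k a j).sum := by
  induction γ with
  | nil => simp [pPlus, pMinus]
  | cons a γ ih =>
    rw [pPlus_cons, pMinus_cons, List.map_cons, List.sum_cons, ← ih, Arc.signedJump]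
    push_cast
    ring

/-- Along a walk, differences of a potential telescope. -/
lemma sum_map_head_sub_tail (ℓ : Fin m → ZMod n) (k : Fin m → ℕ) (g : ZMod n → ℤ)
    (γ : List (Arc m n)) (h : γ ≠ [])
    (hc : List.IsChain (fun a b => Arc.head ℓ k a = Arc.tail ℓ k b) γ) :
    (γ.map fun a => g (Arc.head ℓ k a) - g (Arc.tail ℓ k a)).sum =
      g (Arc.head ℓ k (γ.getLast h)) - g (Arc.tail ℓ k (γ.head h)) := by
  induction γ with
  | nil => exact absurd rfl h
  | cons a γ ih =>
    cases γ with
    | nil => simp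
    | cons c γ =>
      rw [List.isChain_cons_cons] at hc
      rw [List.map_cons, List.sum_cons, ih (List.cons_ne_nil c γ) hc.2,
        List.getLast_cons (List.cons_ne_nil c γ), List.head_cons, List.head_cons, hc.1]
      ring

lemma IsClosedWalk.sum_map_head_sub_tail {ℓ : Fin m → ZMod n} {k : Fin m → ℕ}
    {γ : List (Arc m n)} (hγ : IsClosedWalk ℓ k γ) (g : ZMod n → ℤ) :
    (γ.map fun a => g (Arc.head ℓ k a) - g (Arc.tail ℓ k a)).sum = 0 := by
  obtain ⟨h, hc, hl⟩ := hγ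
  rw [CircCover.sum_map_head_sub_tail ℓ k g γ h hc, hl, sub_self]

lemma IsClosedWalk.pPlus_sub_pMinus_succ [NeZero n] {ℓ : Fin m → ZMod n} {k : Fin m → ℕ}
    (hk : ∀ i, k i ≤ n) {γ : List (Arc m n)} (hγ : IsClosedWalk ℓ k γ) (j : ZMod n) :
    (pPlus ℓ k γ (j + 1) : ℤ) - pMinus ℓ k γ (j + 1) = pPlus ℓ k γ j - pMinus ℓ k γ j := by
  have h := hγ.sum_map_head_sub_tail fun v => if j = v then 1 else 0
  simp_rw [← Arc.signedJump_sub_succ ℓ k hk] at h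
  have hsub := Multiset.sum_map_sub (m := (γ : Multiset (Arc m n)))
    (f := fun a => Arc.signedJump ℓ k a j) (g := fun a => Arc.signedJump ℓ k a (j + 1))
  simp only [Multiset.map_coe, Multiset.sum_coe] at hsub
  rw [pPlus_sub_pMinus, pPlus_sub_pMinus]
  linarith

/-- Every node is jumped over `p` more times by forward arcs than by reverse arcs, where `p` is
the winding number. -/
lemma IsClosedWalk.pPlus_sub_pMinus_eq [NeZero n] {ℓ : Fin m → ZMod n} {k : Fin m → ℕ}
    (hk : ∀ i, k i ≤ n) {γ : List (Arc m n)} (hγ : IsClosedWalk ℓ k γ) {p : ℤ}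
    (hp : p * (n : ℤ) = windingSum k γ) (j : ZMod n) :
    (pPlus ℓ k γ j : ℤ) - pMinus ℓ k γ j = p := by
  have hnat : ∀ s : ℕ, (pPlus ℓ k γ (s : ZMod n) : ℤ) - pMinus ℓ k γ (s : ZMod n) =
      pPlus ℓ k γ 0 - pMinus ℓ k γ 0 := by
    intro s
    induction s with
    | zero => simp
    | succ s ih => rw [Nat.cast_succ, hγ.pPlus_sub_pMinus_succ hk, ih]
  have hconst : ∀ i : ZMod n, (pPlus ℓ k γ i : ℤ) - pMinus ℓ k γ i =
      pPlus ℓ k γ 0 - pMinus ℓ k γ 0 := fun i => by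
    simpa using hnat i.val
  have hsum : ∑ i : ZMod n, ((pPlus ℓ k γ i : ℤ) - pMinus ℓ k γ i) = windingSum k γ := by
    simp_rw [pPlus_sub_pMinus, windingSum]
    clear hγ hp hnat hconst
    induction γ with
    | nil => simp
    | cons a γ ih => simp [Finset.sum_add_distrib, ih, Arc.sum_signedJump ℓ k hk]
  simp_rw [hconst] at hsum
  rw [Finset.sum_const, Finset.card_univ, ZMod.card, nsmul_eq_mul, ← hp] at hsum
  have hn : (n : ℤ) ≠ 0 := Nat.cast_ne_zero.2 (NeZero.ne n)
  rw [hconst]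
  exact mul_left_cancel₀ hn (hsum.trans (mul_comm _ _))

lemma tMinusVal_le_sum_pMinus [NeZero n] (ℓ : Fin m → ZMod n) (k : Fin m → ℕ) (b : Fin m → ℤ)
    {x : ZMod n → ℝ} (hx : x ∈ Qpoly (circMatrix ℓ k) (fun i => (b i : ℝ)))
    (γ : List (Arc m n)) :
    (tMinusVal b γ : ℝ) ≤ ∑ j : ZMod n, (pMinus ℓ k γ j : ℝ) * x j := by
  induction γ with
  | nil => simp [tMinusVal, pMinus]
  | cons a γ ih =>
    simp_rw [pMinus_cons]
    push_cast
    simp_rw [add_mul, Finset.sum_add_distrib]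
    rw [tMinusVal, List.map_cons, List.sum_cons, ← tMinusVal, Int.cast_add, add_comm]
    refine add_le_add ih ?_
    cases a with
    | fwdRow i => simp [Arc.IsForward]
    | fwdShort j => simp [Arc.IsForward]
    | revRow i => simpa [Arc.IsForward, Arc.Jumps, circMatrix] using hx.2 i
    | revShort j => simpa [Arc.IsForward, Arc.Jumps] using hx.1 j

lemma tVal_add_tMinusVal_le_sum_pPlus [NeZero n] (ℓ : Fin m → ZMod n) (k : Fin m → ℕ)
    (b : Fin m → ℤ) {x : ZMod n → ℝ}
    (hx : x ∈ Qpoly (circMatrix ℓ k) (fun i => (b i : ℝ))) (γ : List (Arc m n)) :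
    (tVal b γ : ℝ) + (tMinusVal b γ : ℝ) ≤ ∑ j : ZMod n, (pPlus ℓ k γ j : ℝ) * x j := by
  induction γ with
  | nil => simp [tVal, tMinusVal, pPlus]
  | cons a γ ih =>
    simp_rw [pPlus_cons]
    push_cast
    simp_rw [add_mul, Finset.sum_add_distrib]
    rw [tMinusVal, List.map_cons, List.sum_cons, ← tMinusVal, tVal, List.map_cons,
      List.sum_cons, ← tVal, Int.cast_add, Int.cast_add, add_add_add_comm, add_comm]
    refine add_le_add ih ?_
    cases a with
    | fwdRow i => simpa [Arc.IsForward, Arc.Jumps, circMatrix] using hx.2 i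
    | fwdShort j => simpa [Arc.IsForward, Arc.Jumps] using hx.1 j
    | revRow i => simp [Arc.IsForward]
    | revShort j => simp [Arc.IsForward]

lemma gammaIneqHolds_of_isIntegerPoint [NeZero n] {ℓ : Fin m → ZMod n} {k : Fin m → ℕ}
    (hk : ∀ i, k i ≤ n) (b : Fin m → ℤ) {γ : List (Arc m n)} (hγ : IsClosedWalk ℓ k γ) {p : ℤ}
    (hp : p * (n : ℤ) = windingSum k γ) (hp0 : 0 < p) {x : ZMod n → ℝ}
    (hint : IsIntegerPoint x) (hx : x ∈ Qpoly (circMatrix ℓ k) (fun i => (b i : ℝ))) :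
    GammaIneqHolds ℓ k b γ p x := by
  choose z hz using hint
  set S : ℤ := ∑ j : ZMod n, z j with hS
  have hT : ∑ j : ZMod n, x j = (S : ℝ) := by simp [hS, hz]
  have hr : rVal b γ p = tVal b γ % p := by
    rw [rVal, betaVal, Int.fdiv_eq_ediv_of_nonneg _ hp0.le, Int.emod_def, mul_comm]
  have hr0 : (0 : ℝ) ≤ rVal b γ p := by
    exact_mod_cast hr ▸ Int.emod_nonneg _ hp0.ne'
  have hrp : (rVal b γ p : ℝ) ≤ p := by
    exact_mod_cast (hr ▸ Int.emod_lt_of_pos _ hp0 : rVal b γ p < p).le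
  have ht : (tVal b γ : ℝ) = betaVal b γ p * p + rVal b γ p := by
    rw [rVal]
    push_cast
    ring
  have hminus := tMinusVal_le_sum_pMinus ℓ k b hx γ
  have hplus := tVal_add_tMinusVal_le_sum_pPlus ℓ k b hx γ
  have hpp : ∀ j, (pPlus ℓ k γ j : ℝ) = pMinus ℓ k γ j + p := fun j => by
    have h := hγ.pPlus_sub_pMinus_eq hk hp j
    have h' : (pPlus ℓ k γ j : ℤ) = pMinus ℓ k γ j + p := by linarith
    exact_mod_cast h'
  simp_rw [hpp, add_mul, Finset.sum_add_distrib, ← Finset.mul_sum] at hplus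
  simp only [GammaIneqHolds, add_mul, Finset.sum_add_distrib, ← Finset.mul_sum]
  rw [hT] at hplus ⊢
  rcases le_or_gt (betaVal b γ p + 1) S with h | h
  · have h' : (betaVal b γ p : ℝ) + 1 ≤ S := by exact_mod_cast h
    linarith [mul_le_mul_of_nonneg_left h' hr0]
  · have h' : (S : ℝ) ≤ betaVal b γ p := by exact_mod_cast Int.lt_add_one_iff.1 h
    linarith [mul_le_mul_of_nonneg_right hrp (sub_nonneg.2 h')]

lemma convex_gammaIneqHolds [NeZero n] (ℓ : Fin m → ZMod n) (k : Fin m → ℕ) (b : Fin m → ℤ)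
    (γ : List (Arc m n)) (p : ℤ) : Convex ℝ {x | GammaIneqHolds ℓ k b γ p x} := by
  refine convex_halfSpace_ge ⟨fun x y => ?_, fun c x => ?_⟩ _
  · simp [mul_add, Finset.sum_add_distrib]
  · simp only [Pi.smul_apply, smul_eq_mul, Finset.mul_sum]
    exact Finset.sum_congr rfl fun j _ => by ring

/-- For any simple directed circuit `Γ` in `D(A)` with positive winding
number, the `Γ`-inequality is valid for `Q*(A, b)`. -/
theorem gammaIneq_valid {m n : ℕ} [NeZero n] (ℓ : Fin m → ZMod n) (k : Fin m → ℕ)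
    (hA : circBounds n k) (b : Fin m → ℤ) (hb : ∀ i, 0 ≤ b i)
    (γ : List (Arc m n)) (hγ : IsCircuit ℓ k γ)
    (p : ℤ) (hp : p * (n : ℤ) = windingSum k γ) (hp0 : 0 < p) :
    ∀ x ∈ Qstar (circMatrix ℓ k) (fun i => (b i : ℝ)),
      GammaIneqHolds ℓ k b γ p x := by
  have hk : ∀ i, k i ≤ n := fun i => (hA i).2.trans (Nat.sub_le n 1)
  exact fun x hx => convexHull_min
    (fun y hy => gammaIneqHolds_of_isIntegerPoint hk b hγ.1 hp hp0 hy.1 hy.2)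
    (convex_gammaIneqHolds ℓ k b γ p) hx

end CircCover
end
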